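/- arXiv:1611.03564 — 3 statements merged into one kernel-verified Lean document; each statement's English description precedes it below -/
import Mathlib

section
/- Let w : ℝ³ → ℝ be smooth and suppose: Tw = ∂_t w ≡ c₂ is constant, Δ_b w ≡ c₁ is constant, and there are a compact set K ⊂ ℝ³ and M ≥ 0 with (Xw)² + (Yw)² ≤ M on ℝ³∖K. Then there is a polynomial q(x,y) of degree at most 2 in the variables (x,y) such that w(x,y,t) = c₂ t + q(x,y) for all (x,y,t) ∈ ℝ³. -/
open MeasureTheory Real

noncomputable section

/-- The Heisenberg group `ℍ¹` as `ℝ³` with coordinates `(x, y, t)`. -/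
abbrev Heis : Type := ℝ × ℝ × ℝ

/-- Group law `(z,t)·(z',t') = (z+z', t+t'+2 Im(z ⬝ conj z'))`. -/
def Hmul (p q : Heis) : Heis :=
  (p.1 + q.1, p.2.1 + q.2.1, p.2.2 + q.2.2 + 2 * (p.2.1 * q.1 - p.1 * q.2.1))

/-- Group inverse `(z,t)⁻¹ = (-z,-t)`. -/
def Hinv (p : Heis) : Heis := (-p.1, -p.2.1, -p.2.2)

/-- Korányi norm `ρ(z,t) = (|z|⁴ + t²)^(1/4)`. -/
def rho (p : Heis) : ℝ := ((p.1 ^ 2 + p.2.1 ^ 2) ^ 2 + p.2.2 ^ 2) ^ ((1 : ℝ) / 4)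

/-- Korányi ball `B(p,r) = {q : ρ(p⁻¹ q) < r}`. -/
def Kball (p : Heis) (r : ℝ) : Set Heis := {q | rho (Hmul (Hinv p) q) < r}

/-- The left-invariant vector field `X = ∂ₓ + 2y ∂_t` acting on a function. -/
def Xd (f : Heis → ℝ) (p : Heis) : ℝ := fderiv ℝ f p (1, 0, 2 * p.2.1)

/-- The left-invariant vector field `Y = ∂_y − 2x ∂_t` acting on a function. -/
def Yd (f : Heis → ℝ) (p : Heis) : ℝ := fderiv ℝ f p (0, 1, -(2 * p.1))

/-- The vector field `T = ∂_t`. -/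
def Td (f : Heis → ℝ) (p : Heis) : ℝ := fderiv ℝ f p (0, 0, 1)

/-- Sub-Laplacian `Δ_b = X² + Y²`. -/
def subLap (f : Heis → ℝ) : Heis → ℝ := fun p => Xd (Xd f) p + Yd (Yd f) p

/-- Squared length of the horizontal gradient: `|∇_b f|² = (Xf)² + (Yf)²`. -/
def gradb2 (f : Heis → ℝ) (p : Heis) : ℝ := (Xd f p) ^ 2 + (Yd f p) ^ 2

/-- Coordinate partial derivative `∂_t`. -/
def pdt (f : Heis → ℝ) (p : Heis) : ℝ := fderiv ℝ f p (0, 0, 1)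

lemma two_le_infty : (2 : WithTop ℕ∞) ≤ ((⊤ : ℕ∞) : WithTop ℕ∞) :=
  WithTop.coe_le_coe.2 (le_top : (2 : ℕ∞) ≤ ⊤)

lemma hasFDerivAt_fderiv {w : Heis → ℝ} (hw : ContDiff ℝ (⊤ : ℕ∞) w) (p : Heis) :
    HasFDerivAt (fderiv ℝ w) (fderiv ℝ (fderiv ℝ w) p) p :=
  (((hw.of_le two_le_infty).fderiv_right (m := 1) (by norm_num)).differentiable
    (by simp) p).hasFDerivAt

lemma hasFDerivAt_Xd {w : Heis → ℝ} (hw : ContDiff ℝ (⊤ : ℕ∞) w) (p : Heis) :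
    HasFDerivAt (Xd w)
      ((fderiv ℝ w p).comp ((2 : ℝ) • (ContinuousLinearMap.inr ℝ ℝ (ℝ × ℝ)).comp
          ((ContinuousLinearMap.inr ℝ ℝ ℝ).comp
            ((ContinuousLinearMap.fst ℝ ℝ ℝ).comp (ContinuousLinearMap.snd ℝ ℝ (ℝ × ℝ)))))
        + (fderiv ℝ (fderiv ℝ w) p).flip (1, 0, 2 * p.2.1)) p := by
  have h2 : HasFDerivAt (fun q : Heis => ((1, 0, 2 * q.2.1) : Heis))
      ((2 : ℝ) • (ContinuousLinearMap.inr ℝ ℝ (ℝ × ℝ)).comp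
          ((ContinuousLinearMap.inr ℝ ℝ ℝ).comp
            ((ContinuousLinearMap.fst ℝ ℝ ℝ).comp (ContinuousLinearMap.snd ℝ ℝ (ℝ × ℝ))))) p := by
    refine ((ContinuousLinearMap.hasFDerivAt _).const_add ((1, 0, 0) : Heis)).congr_of_eventuallyEq
      (.of_forall fun q => ?_)
    simp
  exact (hasFDerivAt_fderiv hw p).clm_apply h2

lemma hasFDerivAt_Yd {w : Heis → ℝ} (hw : ContDiff ℝ (⊤ : ℕ∞) w) (p : Heis) :
    HasFDerivAt (Yd w)
      ((fderiv ℝ w p).comp ((-2 : ℝ) • (ContinuousLinearMap.inr ℝ ℝ (ℝ × ℝ)).comp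
          ((ContinuousLinearMap.inr ℝ ℝ ℝ).comp (ContinuousLinearMap.fst ℝ ℝ (ℝ × ℝ))))
        + (fderiv ℝ (fderiv ℝ w) p).flip (0, 1, -(2 * p.1))) p := by
  have h2 : HasFDerivAt (fun q : Heis => ((0, 1, -(2 * q.1)) : Heis))
      ((-2 : ℝ) • (ContinuousLinearMap.inr ℝ ℝ (ℝ × ℝ)).comp
          ((ContinuousLinearMap.inr ℝ ℝ ℝ).comp (ContinuousLinearMap.fst ℝ ℝ (ℝ × ℝ)))) p := by
    refine ((ContinuousLinearMap.hasFDerivAt _).const_add ((0, 1, 0) : Heis)).congr_of_eventuallyEq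
      (.of_forall fun q => ?_)
    simp
  exact (hasFDerivAt_fderiv hw p).clm_apply h2

lemma fderiv_Xd_apply {w : Heis → ℝ} (hw : ContDiff ℝ (⊤ : ℕ∞) w) (p v : Heis) :
    fderiv ℝ (Xd w) p v =
      2 * v.2.1 * pdt w p + fderiv ℝ (fderiv ℝ w) p v (1, 0, 2 * p.2.1) := by
  have h : ((0, 0, v.2.1) : Heis) = v.2.1 • (0, 0, 1) := by simp
  simp [(hasFDerivAt_Xd hw p).fderiv, pdt, h, mul_assoc, -Prod.smul_mk]

lemma fderiv_Yd_apply {w : Heis → ℝ} (hw : ContDiff ℝ (⊤ : ℕ∞) w) (p v : Heis) :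
    fderiv ℝ (Yd w) p v =
      -(2 * v.1 * pdt w p) + fderiv ℝ (fderiv ℝ w) p v (0, 1, -(2 * p.1)) := by
  have h : ((0, 0, v.1) : Heis) = v.1 • (0, 0, 1) := by simp
  simp [(hasFDerivAt_Yd hw p).fderiv, pdt, h, mul_assoc, -Prod.smul_mk]

lemma fderiv_fderiv_symm {w : Heis → ℝ} (hw : ContDiff ℝ (⊤ : ℕ∞) w) (p u v : Heis) :
    fderiv ℝ (fderiv ℝ w) p u v = fderiv ℝ (fderiv ℝ w) p v u :=
  (hw.contDiffAt.isSymmSndFDerivAt (by simpa using two_le_infty)).eq u v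

/-- The commutator relation `[X, Y] = -4T`. -/
lemma Xd_Yd_sub_Yd_Xd {w : Heis → ℝ} (hw : ContDiff ℝ (⊤ : ℕ∞) w) (p : Heis) :
    Xd (Yd w) p - Yd (Xd w) p = -4 * pdt w p := by
  rw [Xd, Yd, fderiv_Xd_apply hw, fderiv_Yd_apply hw, fderiv_fderiv_symm hw p (0, 1, _)]
  ring

lemma fderiv_fderiv_vertical {w : Heis → ℝ} (hw : ContDiff ℝ (⊤ : ℕ∞) w) {c : ℝ}
    (hT : ∀ p, pdt w p = c) (p v : Heis) :
    fderiv ℝ (fderiv ℝ w) p (0, 0, 1) v = 0 := by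
  have h2 := (hasFDerivAt_fderiv hw p).clm_apply (hasFDerivAt_const ((0, 0, 1) : Heis) p)
  have h3 : (fun q => fderiv ℝ w q (0, 0, 1)) = fun _ => c := funext hT
  rw [h3] at h2
  have h4 := DFunLike.congr_fun (h2.unique (hasFDerivAt_const c p)) v
  rw [fderiv_fderiv_symm hw]
  simpa using h4

lemma pdt_Xd {w : Heis → ℝ} (hw : ContDiff ℝ (⊤ : ℕ∞) w) {c : ℝ}
    (hT : ∀ p, pdt w p = c) (p : Heis) : pdt (Xd w) p = 0 := by
  rw [pdt, fderiv_Xd_apply hw, fderiv_fderiv_vertical hw hT]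
  simp

lemma pdt_Yd {w : Heis → ℝ} (hw : ContDiff ℝ (⊤ : ℕ∞) w) {c : ℝ}
    (hT : ∀ p, pdt w p = c) (p : Heis) : pdt (Yd w) p = 0 := by
  rw [pdt, fderiv_Yd_apply hw, fderiv_fderiv_vertical hw hT]
  simp

lemma eq_of_pdt_eq_zero {f : Heis → ℝ} (hf : Differentiable ℝ f) (h : ∀ p, pdt f p = 0)
    (x y s t : ℝ) : f (x, y, s) = f (x, y, t) := by
  have hd : ∀ r, HasDerivAt (fun r : ℝ => f (x, y, r)) 0 r := fun r => by
    have hl : HasDerivAt (fun r : ℝ => ((x, y, r) : Heis)) (0, 0, 1) r :=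
      (hasDerivAt_const r x).prodMk ((hasDerivAt_const r y).prodMk (hasDerivAt_id r))
    have hc := (hf (x, y, r)).hasFDerivAt.comp_hasDerivAt r hl
    rwa [← pdt, h] at hc
  exact is_const_of_deriv_eq_zero (fun r => (hd r).differentiableAt) (fun r => (hd r).deriv) s t

/-- Every vertical line leaves a compact set. -/
lemma exists_vertical_notMem {K : Set Heis} (hK : IsCompact K) (x y : ℝ) :
    ∃ t : ℝ, ((x, y, t) : Heis) ∉ K := by
  by_contra! h
  have hc : IsCompact ((fun p : Heis => p.2.2) '' K) := hK.image (by fun_prop)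
  have : (fun p : Heis => p.2.2) '' K = Set.univ :=
    Set.eq_univ_of_forall fun t => ⟨(x, y, t), h t, rfl⟩
  exact noncompact_univ ℝ (this ▸ hc)

/-- A bounded real-differentiable function on `ℂ` whose `∂̄`-derivative is constant is constant. -/
lemma eq_of_bounded_of_dbar_const {f : ℂ → ℂ} {f' : ℂ → ℂ →L[ℝ] ℂ}
    (hf : ∀ z, HasFDerivAt f (f' z) z) {k : ℂ}
    (hk : ∀ z, f' z Complex.I - Complex.I * f' z 1 = k) {C : ℝ} (hC : ∀ z, ‖f z‖ ≤ C)
    (z w : ℂ) : f z = f w := by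
  have key : ∀ a z, f (z + a) - f z = f (0 + a) - f 0 := fun a z => by
    have hd : Differentiable ℂ fun z => f (z + a) - f z := fun z => by
      have h1 : HasFDerivAt (fun z => f (z + a) - f z) (f' (z + a) - f' z) z :=
        ((hasFDerivAt_comp_add_right a).2 (hf (z + a))).sub (hf z)
      refine (hasFDerivAt_of_restrictScalars ℝ (f' := ContinuousLinearMap.toSpanSingleton ℂ
        ((f' (z + a) - f' z) 1)) h1 ?_).differentiableAt
      ext1 v
      have hv : v = v.re • (1 : ℂ) + v.im • Complex.I := by
        simp [Complex.re_add_im]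
      have hI : (f' (z + a) - f' z) Complex.I = Complex.I * (f' (z + a) - f' z) 1 := by
        simp only [sub_apply]
        linear_combination hk (z + a) - hk z
      rw [show (f' (z + a) - f' z) v = v.re • (f' (z + a) - f' z) 1
        + v.im • (f' (z + a) - f' z) Complex.I by rw [← map_smul, ← map_smul, ← map_add, ← hv], hI]
      conv_lhs => rw [hv]
      simp only [ContinuousLinearMap.coe_restrictScalars',
        ContinuousLinearMap.toSpanSingleton_apply, Complex.real_smul, smul_eq_mul]
      ring
    refine hd.apply_eq_apply_of_bounded ?_ z 0
    refine isBounded_iff_forall_norm_le.2 ⟨C + C, ?_⟩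
    rintro _ ⟨z, rfl⟩
    exact (norm_sub_le _ _).trans (add_le_add (hC _) (hC _))
  have hn : ∀ n : ℕ, f (w + n * (z - w)) = f w + n * (f z - f w) := fun n => by
    induction n with
    | zero => simp
    | succ n ih =>
      have h1 := key (z - w) (w + n * (z - w))
      have h2 := key (z - w) w
      rw [add_sub_cancel] at h2
      push_cast
      rw [show w + (n + 1) * (z - w) = w + n * (z - w) + (z - w) by ring]
      linear_combination h1 - h2 + ih
  by_contra hne
  have hpos : 0 < ‖f z - f w‖ := norm_pos_iff.2 (sub_ne_zero.2 hne)
  obtain ⟨n, hlt⟩ := exists_nat_gt ((C + C) / ‖f z - f w‖)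
  rw [div_lt_iff₀ hpos] at hlt
  have h1 : (n : ℂ) * (f z - f w) = f (w + n * (z - w)) - f w := by rw [hn]; ring
  have h2 : n * ‖f z - f w‖ ≤ C + C := by
    calc n * ‖f z - f w‖ = ‖(n : ℂ) * (f z - f w)‖ := by simp
      _ ≤ C + C := by rw [h1]; exact (norm_sub_le _ _).trans (add_le_add (hC _) (hC _))
  linarith

/-- The inclusion of `ℂ` in the Heisenberg group as the plane `t = 0`. -/
def horizontalEmbedding : ℂ →L[ℝ] Heis :=
  Complex.reCLM.prod (Complex.imCLM.prod 0)

lemma Xd_eq_of_pdt_eq_zero {f : Heis → ℝ} (h : ∀ p, pdt f p = 0) (p : Heis) :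
    Xd f p = fderiv ℝ f p (1, 0, 0) := by
  have hv : ((1, 0, 2 * p.2.1) : Heis) = (1, 0, 0) + (2 * p.2.1) • (0, 0, 1) := by simp
  have hp := h p
  rw [pdt] at hp
  rw [Xd, hv, map_add, map_smul, hp]
  simp

lemma Yd_eq_of_pdt_eq_zero {f : Heis → ℝ} (h : ∀ p, pdt f p = 0) (p : Heis) :
    Yd f p = fderiv ℝ f p (0, 1, 0) := by
  have hv : ((0, 1, -(2 * p.1)) : Heis) = (0, 1, 0) + (-(2 * p.1)) • (0, 0, 1) := by simp
  have hp := h p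
  rw [pdt] at hp
  rw [Yd, hv, map_add, map_smul, hp]
  simp

/-- A function with constant `Tw` and `Δ_b w` and with horizontal gradient bounded off a compact
set has constant horizontal gradient. -/
lemma horizontal_gradient_const {w : Heis → ℝ} (hw : ContDiff ℝ (⊤ : ℕ∞) w) {c₁ c₂ M : ℝ}
    (hT : ∀ p, pdt w p = c₂) (hΔ : ∀ p, subLap w p = c₁) {K : Set Heis} (hK : IsCompact K)
    (hM : ∀ p ∉ K, (Xd w p) ^ 2 + (Yd w p) ^ 2 ≤ M) (p : Heis) :
    Xd w p = Xd w 0 ∧ Yd w p = Yd w 0 := by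
  have hX : Differentiable ℝ (Xd w) := fun p => (hasFDerivAt_Xd hw p).differentiableAt
  have hY : Differentiable ℝ (Yd w) := fun p => (hasFDerivAt_Yd hw p).differentiableAt
  have hXt := eq_of_pdt_eq_zero hX (pdt_Xd hw hT)
  have hYt := eq_of_pdt_eq_zero hY (pdt_Yd hw hT)
  have hb : ∀ p, (Xd w p) ^ 2 + (Yd w p) ^ 2 ≤ M := fun ⟨x, y, t⟩ => by
    obtain ⟨s, hs⟩ := exists_vertical_notMem hK x y
    rw [hXt x y t s, hYt x y t s]
    exact hM _ hs
  let f : ℂ → ℂ := fun z =>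
    (Xd w (horizontalEmbedding z) : ℂ) - Complex.I * (Yd w (horizontalEmbedding z) : ℂ)
  let f' : ℂ → ℂ →L[ℝ] ℂ := fun z =>
    Complex.ofRealCLM.comp ((fderiv ℝ (Xd w) (horizontalEmbedding z)).comp horizontalEmbedding) -
      Complex.I • Complex.ofRealCLM.comp
        ((fderiv ℝ (Yd w) (horizontalEmbedding z)).comp horizontalEmbedding)
  have hf : ∀ z, HasFDerivAt f (f' z) z := fun z =>
    (Complex.ofRealCLM.hasFDerivAt.comp z
      ((hX _).hasFDerivAt.comp z horizontalEmbedding.hasFDerivAt)).sub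
    ((Complex.ofRealCLM.hasFDerivAt.comp z
      ((hY _).hasFDerivAt.comp z horizontalEmbedding.hasFDerivAt)).const_smul Complex.I)
  have hk : ∀ z, f' z Complex.I - Complex.I * f' z 1 = 4 * c₂ - Complex.I * c₁ := fun z => by
    have h1 : horizontalEmbedding 1 = (1, 0, 0) := by simp [horizontalEmbedding]
    have hI : horizontalEmbedding Complex.I = (0, 1, 0) := by simp [horizontalEmbedding]
    simp only [f', sub_apply, smul_apply,
      ContinuousLinearMap.comp_apply, Complex.ofRealCLM_apply, smul_eq_mul, h1, hI,
      ← Xd_eq_of_pdt_eq_zero (pdt_Xd hw hT), ← Xd_eq_of_pdt_eq_zero (pdt_Yd hw hT),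
      ← Yd_eq_of_pdt_eq_zero (pdt_Xd hw hT), ← Yd_eq_of_pdt_eq_zero (pdt_Yd hw hT)]
    have hc := Xd_Yd_sub_Yd_Xd hw (horizontalEmbedding z)
    have hl := hΔ (horizontalEmbedding z)
    rw [hT] at hc
    rw [subLap] at hl
    have hc' := congrArg Complex.ofReal hc
    have hl' := congrArg Complex.ofReal hl
    push_cast at hc' hl'
    linear_combination (-1 : ℂ) * hc' - Complex.I * hl' + (Xd (Yd w) (horizontalEmbedding z) : ℂ)
      * Complex.I_sq
  have hC : ∀ z, ‖f z‖ ≤ √M := fun z => by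
    refine Real.le_sqrt_of_sq_le ?_
    rw [← Complex.normSq_eq_norm_sq, Complex.normSq_apply]
    have := hb (horizontalEmbedding z)
    simp only [f, Complex.sub_re, Complex.sub_im, Complex.ofReal_re, Complex.ofReal_im,
      Complex.mul_re, Complex.mul_im, Complex.I_re, Complex.I_im]
    linarith
  have h0 := eq_of_bounded_of_dbar_const hf hk hC ⟨p.1, p.2.1⟩ 0
  have hre := congrArg Complex.re h0
  have him := congrArg Complex.im h0
  have hE : horizontalEmbedding ⟨p.1, p.2.1⟩ = (p.1, p.2.1, 0) := by simp [horizontalEmbedding]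
  simp only [f, hE, map_zero, Complex.sub_re, Complex.sub_im, Complex.ofReal_re,
    Complex.ofReal_im, Complex.mul_re, Complex.mul_im, Complex.I_re, Complex.I_im] at hre him
  have hpX := hXt p.1 p.2.1 p.2.2 0
  have hpY := hYt p.1 p.2.1 p.2.2 0
  simp only [Prod.mk.eta] at hpX hpY
  constructor <;> linarith

/-- if `Tw ≡ c₂`, `Δ_b w ≡ c₁`, and the horizontal gradient is bounded off a
compact set, then `w(x,y,t) = c₂ t + q(x,y)` with `q` a polynomial of degree at most `2`. -/
theorem eq_linear_in_t_plus_quadratic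
    (w : Heis → ℝ) (hw : ContDiff ℝ (⊤ : ℕ∞) w) (c₁ c₂ : ℝ)
    (hT : ∀ p, pdt w p = c₂)
    (hΔ : ∀ p, subLap w p = c₁)
    (hbdd : ∃ (K : Set Heis) (M : ℝ), IsCompact K ∧ 0 ≤ M ∧
      ∀ p ∉ K, (Xd w p) ^ 2 + (Yd w p) ^ 2 ≤ M) :
    ∃ a₀ a₁ a₂ a₃ a₄ a₅ : ℝ, ∀ p : Heis,
      w p = c₂ * p.2.2 +
        (a₀ + a₁ * p.1 + a₂ * p.2.1 + a₃ * p.1 ^ 2 + a₄ * (p.1 * p.2.1) + a₅ * p.2.1 ^ 2) := by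
  obtain ⟨K, M, hK, -, hM⟩ := hbdd
  have hgrad := horizontal_gradient_const hw hT hΔ hK hM
  have hX : Xd w = fun _ => Xd w 0 := funext fun p => (hgrad p).1
  have hY : Yd w = fun _ => Yd w 0 := funext fun p => (hgrad p).2
  have hc : c₂ = 0 := by
    have h := Xd_Yd_sub_Yd_Xd hw 0
    rw [hX, hY, hT] at h
    simp only [Xd, Yd, fderiv_fun_const, Pi.zero_apply, zero_apply] at h
    linarith
  subst hc
  let L : Heis →L[ℝ] ℝ := Xd w 0 • ContinuousLinearMap.fst ℝ ℝ (ℝ × ℝ) +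
    Yd w 0 • (ContinuousLinearMap.fst ℝ ℝ ℝ).comp (ContinuousLinearMap.snd ℝ ℝ (ℝ × ℝ))
  have hdw : ∀ p, fderiv ℝ w p = L := fun p => by
    have hx := (hgrad p).1
    have hy := (hgrad p).2
    rw [Xd_eq_of_pdt_eq_zero hT, Prod.mk_zero_zero] at hx
    rw [Yd_eq_of_pdt_eq_zero hT] at hy
    have ht := hT p
    rw [pdt] at ht
    ext <;> simp [L, hx, hy, ht]
  have hd : Differentiable ℝ w := hw.differentiable (by simp)
  refine ⟨w 0, Xd w 0, Yd w 0, 0, 0, 0, fun p => ?_⟩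
  have h := is_const_of_fderiv_eq_zero (𝕜 := ℝ) (hd.sub L.differentiable) (fun q => by
    rw [fderiv_sub (hd q) (L.differentiable q), hdw, L.fderiv, sub_self]) p 0
  simp [L] at h
  linarith

end
end

section
/- There exists a finite constant C such that for every q ∈ ℍ¹, ∫_{∂B₁} ρ(q⁻¹x)⁻¹ dσ(x) ≤ C, where σ is the surface measure on the Korányi unit sphere ∂B₁ = {p ∈ ℍ¹ : ρ(p) = 1}. -/
open MeasureTheory Real

noncomputable section

/-- The open unit disk in the `(x₁,x₂)`-plane. -/
def unitDisk : Set (ℝ × ℝ) := {v | v.1 ^ 2 + v.2 ^ 2 < 1}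

/-- `g(x₁,x₂) = √(1 − (x₁²+x₂²)²)`, whose graphs are the two halves of the Korányi
unit sphere. -/
def gcap (v : ℝ × ℝ) : ℝ := Real.sqrt (1 - (v.1 ^ 2 + v.2 ^ 2) ^ 2)

/-- Area density `√((∂_{x₁}u − x₂)² + (∂_{x₂}u + x₁)²)` of the graph of `u`. -/
def graphDens (u : ℝ × ℝ → ℝ) (v : ℝ × ℝ) : ℝ :=
  Real.sqrt ((fderiv ℝ u v (1, 0) - v.2) ^ 2 + (fderiv ℝ u v (0, 1) + v.1) ^ 2)

/-- The surface measure `σ` on the Korányi unit sphere `∂B₁ = {ρ = 1}`: the sum of the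
pushforwards, under the two graph maps `(x₁,x₂) ↦ (x₁,x₂,±g)`, of the corresponding
area densities on the unit disk. -/
def sigmaSphere : Measure Heis :=
  Measure.map (fun v : ℝ × ℝ => (v.1, v.2, gcap v))
      ((volume.restrict unitDisk).withDensity fun v => ENNReal.ofReal (graphDens gcap v))
    + Measure.map (fun v : ℝ × ℝ => (v.1, v.2, -gcap v))
      ((volume.restrict unitDisk).withDensity
        fun v => ENNReal.ofReal (graphDens (fun w => -gcap w) v))

/-- The kernel `|s|⁻¹`, with the value `∞` at `s = 0`. -/
def invAbs (s : ℝ) : ENNReal := (ENNReal.ofReal |s|)⁻¹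

lemma measurable_invAbs : Measurable invAbs := by
  unfold invAbs
  fun_prop

lemma measurable_invAbs_rpow (α : ℝ) : Measurable fun s => invAbs s ^ α :=
  measurable_invAbs.pow_const α

lemma invAbs_neg (s : ℝ) : invAbs (-s) = invAbs s := by simp [invAbs]

lemma invAbs_anti {s t : ℝ} (h : |s| ≤ |t|) : invAbs t ≤ invAbs s :=
  ENNReal.inv_le_inv.2 (ENNReal.ofReal_le_ofReal h)

lemma ofReal_inv_le_invAbs (s : ℝ) : ENNReal.ofReal s⁻¹ ≤ invAbs s := by
  rcases le_or_gt s 0 with h | h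
  · rw [ENNReal.ofReal_of_nonpos (inv_nonpos.2 h)]
    exact zero_le
  · rw [invAbs, abs_of_pos h, ENNReal.ofReal_inv_of_pos h]

lemma rpow_mul_rpow_le_add (x y : ENNReal) {α β : ℝ} (hα : 0 ≤ α) (hβ : 0 ≤ β) :
    x ^ α * y ^ β ≤ x ^ (α + β) + y ^ (α + β) := by
  rcases le_total x y with h | h
  · calc x ^ α * y ^ β ≤ y ^ α * y ^ β := by gcongr
      _ = y ^ (α + β) := (ENNReal.rpow_add_of_nonneg _ _ hα hβ).symm
      _ ≤ _ := le_add_self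
  · calc x ^ α * y ^ β ≤ x ^ α * x ^ β := by gcongr
      _ = x ^ (α + β) := (ENNReal.rpow_add_of_nonneg _ _ hα hβ).symm
      _ ≤ _ := le_self_add

lemma setLIntegral_invAbs_rpow_lt_top :
    ∫⁻ s in Set.Ioo (-1 : ℝ) 1, invAbs s ^ (7 / 8 : ℝ) < ⊤ := by
  have hint : IntegrableOn (fun s : ℝ => |s| ^ (-(7 / 8) : ℝ)) (Set.Ioo (-1) 1) := by
    have hpos : IntegrableOn (fun s : ℝ => |s| ^ (-(7 / 8) : ℝ)) (Set.Ioo 0 1) :=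
      ((intervalIntegral.integrableOn_Ioo_rpow_iff (s := -(7 / 8)) one_pos).2 (by norm_num)).congr_fun
        (fun s hs => by simp only [abs_of_pos hs.1]) measurableSet_Ioo
    have hneg : IntegrableOn (fun s : ℝ => |s| ^ (-(7 / 8) : ℝ)) (Set.Ioo (-1) 0) := by
      have := hpos.comp_neg
      simpa using this
    have hall : Set.Ioo (-1 : ℝ) 1 ⊆ (Set.Ioo (-1) 0 ∪ {0}) ∪ Set.Ioo 0 1 := by
      intro s hs
      rcases lt_trichotomy s 0 with h | h | h
      · exact Or.inl (Or.inl ⟨hs.1, h⟩)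
      · exact Or.inl (Or.inr h)
      · exact Or.inr ⟨h, hs.2⟩
    exact ((hneg.union (by simp)).union hpos).mono_set hall
  have heq : ∫⁻ s in Set.Ioo (-1 : ℝ) 1, invAbs s ^ (7 / 8 : ℝ)
      = ∫⁻ s in Set.Ioo (-1 : ℝ) 1, ENNReal.ofReal (|s| ^ (-(7 / 8) : ℝ)) := by
    refine lintegral_congr_ae (ae_restrict_of_ae ?_)
    filter_upwards [compl_mem_ae_iff.2 (measure_singleton (0 : ℝ))] with s hs
    rw [invAbs, ← ENNReal.ofReal_rpow_of_pos (abs_pos.2 hs), ENNReal.rpow_neg, ENNReal.inv_rpow]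
  rw [heq]
  exact hint.lintegral_lt_top

lemma exists_setLIntegral_invAbs_sub_rpow_le :
    ∃ K : ENNReal, K ≠ ⊤ ∧
      ∀ a : ℝ, ∫⁻ s in Set.Ioo (-1 : ℝ) 1, invAbs (s - a) ^ (7 / 8 : ℝ) ≤ K := by
  refine ⟨2 + ∫⁻ s in Set.Ioo (-1 : ℝ) 1, invAbs s ^ (7 / 8 : ℝ),
    ENNReal.add_ne_top.2 ⟨by simp, setLIntegral_invAbs_rpow_lt_top.ne⟩, fun a => ?_⟩
  set F : ℝ → ENNReal := (Set.Ioo (-1 : ℝ) 1).indicator fun s => invAbs s ^ (7 / 8 : ℝ) with hF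
  have hpt : ∀ s : ℝ, invAbs (s - a) ^ (7 / 8 : ℝ) ≤ 1 + F (s - a) := by
    intro s
    by_cases h : s - a ∈ Set.Ioo (-1 : ℝ) 1
    · rw [hF, Set.indicator_of_mem h]
      exact le_add_self
    · refine le_trans (ENNReal.rpow_le_one ?_ (by norm_num)) le_self_add
      have h1 : 1 ≤ |s - a| := by
        by_contra! hlt
        exact h (abs_lt.1 hlt)
      simpa [invAbs] using invAbs_anti (s := 1) (t := s - a) (by simpa using h1)
  calc ∫⁻ s in Set.Ioo (-1 : ℝ) 1, invAbs (s - a) ^ (7 / 8 : ℝ)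
      ≤ ∫⁻ s in Set.Ioo (-1 : ℝ) 1, (1 + F (s - a)) := lintegral_mono hpt
    _ = 2 + ∫⁻ s in Set.Ioo (-1 : ℝ) 1, F (s - a) := by
        rw [lintegral_add_left measurable_const]
        norm_num
    _ ≤ 2 + ∫⁻ s, F (s - a) := by
        gcongr
        exact Measure.restrict_le_self
    _ = 2 + ∫⁻ s, F s := by rw [lintegral_sub_right_eq_self]
    _ = _ := by rw [hF, lintegral_indicator measurableSet_Ioo]

lemma abs_le_rho_of_sq_le {p : Heis} {s : ℝ} (h : s ^ 2 ≤ p.1 ^ 2 + p.2.1 ^ 2) :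
    |s| ≤ rho p := by
  have h4 : |s| ^ 4 ≤ (p.1 ^ 2 + p.2.1 ^ 2) ^ 2 + p.2.2 ^ 2 := by
    have := pow_le_pow_left₀ (sq_nonneg s) h 2
    rw [show |s| ^ 4 = (s ^ 2) ^ 2 by rw [← sq_abs s]; ring]
    nlinarith [sq_nonneg p.2.2]
  calc |s| = (|s| ^ 4) ^ ((1 : ℝ) / 4) := by
        rw [← Real.rpow_natCast, ← Real.rpow_mul (abs_nonneg s)]
        norm_num
    _ ≤ rho p := Real.rpow_le_rpow (by positivity) h4 (by norm_num)

lemma ofReal_inv_rho_le (q x : Heis) :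
    ENNReal.ofReal (rho (Hmul (Hinv q) x))⁻¹
      ≤ invAbs (x.1 - q.1) ^ (3 / 8 : ℝ) * invAbs (x.2.1 - q.2.1) ^ (5 / 8 : ℝ) := by
  set r := rho (Hmul (Hinv q) x)
  have h1 : |x.1 - q.1| ≤ r := by
    refine abs_le_rho_of_sq_le ?_
    simp only [Hmul, Hinv]
    nlinarith [sq_nonneg (x.2.1 - q.2.1)]
  have h2 : |x.2.1 - q.2.1| ≤ r := by
    refine abs_le_rho_of_sq_le ?_
    simp only [Hmul, Hinv]
    nlinarith [sq_nonneg (x.1 - q.1)]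
  calc ENNReal.ofReal r⁻¹ ≤ invAbs r := ofReal_inv_le_invAbs r
    _ = invAbs r ^ (3 / 8 : ℝ) * invAbs r ^ (5 / 8 : ℝ) := by
        rw [← ENNReal.rpow_add_of_nonneg _ _ (by norm_num) (by norm_num)]
        norm_num
    _ ≤ _ := by
        gcongr
        · exact invAbs_anti (h1.trans (le_abs_self r))
        · exact invAbs_anti (h2.trans (le_abs_self r))

lemma gcap_arg_pos {v : ℝ × ℝ} (hv : v ∈ unitDisk) : 0 < 1 - (v.1 ^ 2 + v.2 ^ 2) ^ 2 := by
  have h : v.1 ^ 2 + v.2 ^ 2 < 1 := hv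
  nlinarith [sq_nonneg v.1, sq_nonneg v.2]

lemma hasFDerivAt_gcap {v : ℝ × ℝ} (hv : v ∈ unitDisk) :
    HasFDerivAt gcap
      ((-(2 * (v.1 ^ 2 + v.2 ^ 2) * v.1 / gcap v)) • ContinuousLinearMap.fst ℝ ℝ ℝ
        + (-(2 * (v.1 ^ 2 + v.2 ^ 2) * v.2 / gcap v)) • ContinuousLinearMap.snd ℝ ℝ ℝ) v := by
  have h1 : HasFDerivAt (fun w : ℝ × ℝ => w.1) (ContinuousLinearMap.fst ℝ ℝ ℝ) v := hasFDerivAt_fst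
  have h2 : HasFDerivAt (fun w : ℝ × ℝ => w.2) (ContinuousLinearMap.snd ℝ ℝ ℝ) v := hasFDerivAt_snd
  have hg : gcap v ≠ 0 := (Real.sqrt_pos.2 (gcap_arg_pos hv)).ne'
  have h := ((((h1.pow 2).add (h2.pow 2)).pow 2).const_sub 1).sqrt (gcap_arg_pos hv).ne'
  refine h.congr_fderiv ?_
  change (1 / (2 * gcap v)) • _ = _
  ext <;> simp <;> field_simp

lemma sqrt_add_le_three_div {r g : ℝ} (hr : 0 ≤ r) (hr1 : r < 1) (hg : 0 < g)
    (hg2 : g ^ 2 = 1 - r ^ 2) : Real.sqrt (4 * r ^ 3 / g ^ 2 + r) ≤ 3 / g := by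
  refine Real.sqrt_le_iff.2 ⟨by positivity, ?_⟩
  rw [div_pow, div_add' _ _ _ (by positivity)]
  gcongr
  have h3 : r ^ 3 ≤ 1 := pow_le_one₀ hr hr1.le
  nlinarith [sq_nonneg g, sq_nonneg r]

lemma graphDens_gcap_eq {v : ℝ × ℝ} (hv : v ∈ unitDisk) :
    graphDens gcap v
      = Real.sqrt (4 * (v.1 ^ 2 + v.2 ^ 2) ^ 3 / gcap v ^ 2 + (v.1 ^ 2 + v.2 ^ 2)) := by
  have hg : gcap v ≠ 0 := (Real.sqrt_pos.2 (gcap_arg_pos hv)).ne'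
  rw [graphDens, (hasFDerivAt_gcap hv).fderiv]
  congr 1
  simp
  field_simp
  ring

lemma graphDens_neg_gcap_eq {v : ℝ × ℝ} (hv : v ∈ unitDisk) :
    graphDens (fun w => -gcap w) v
      = Real.sqrt (4 * (v.1 ^ 2 + v.2 ^ 2) ^ 3 / gcap v ^ 2 + (v.1 ^ 2 + v.2 ^ 2)) := by
  have hg : gcap v ≠ 0 := (Real.sqrt_pos.2 (gcap_arg_pos hv)).ne'
  rw [graphDens, (hasFDerivAt_gcap hv).fun_neg.fderiv]
  congr 1
  simp
  field_simp
  ring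

lemma sqrt_add_le_three_div_gcap {v : ℝ × ℝ} (hv : v ∈ unitDisk) :
    Real.sqrt (4 * (v.1 ^ 2 + v.2 ^ 2) ^ 3 / gcap v ^ 2 + (v.1 ^ 2 + v.2 ^ 2)) ≤ 3 / gcap v :=
  sqrt_add_le_three_div (by positivity) hv (Real.sqrt_pos.2 (gcap_arg_pos hv))
    (Real.sq_sqrt (gcap_arg_pos hv).le)

lemma measurable_graphDens (u : ℝ × ℝ → ℝ) : Measurable (graphDens u) := by
  have h1 := measurable_fderiv_apply_const ℝ u (1, 0)
  have h2 := measurable_fderiv_apply_const ℝ u (0, 1)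
  unfold graphDens
  fun_prop

lemma invAbs_sqrt {s : ℝ} (hs : 0 ≤ s) : invAbs (Real.sqrt s) = invAbs s ^ (1 / 2 : ℝ) := by
  rw [invAbs, invAbs, abs_of_nonneg (Real.sqrt_nonneg s), abs_of_nonneg hs, Real.sqrt_eq_rpow,
    ENNReal.inv_rpow, ENNReal.ofReal_rpow_of_nonneg hs (by norm_num)]

lemma invAbs_mul (s t : ℝ) : invAbs (s * t) = invAbs s * invAbs t := by
  rw [invAbs, abs_mul, ENNReal.ofReal_mul (abs_nonneg s),
    ENNReal.mul_inv (Or.inr ENNReal.ofReal_ne_top) (Or.inl ENNReal.ofReal_ne_top)]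
  rfl

lemma invAbs_sub_abs_rpow_le (c x α : ℝ) :
    invAbs (c - |x|) ^ α ≤ invAbs (x - c) ^ α + invAbs (x - -c) ^ α := by
  rcases abs_choice x with h | h
  · rw [h, ← invAbs_neg, neg_sub]
    exact le_self_add
  · rw [h, sub_neg_eq_add, sub_neg_eq_add, add_comm c]
    exact le_add_self

lemma invAbs_gcap_le {v : ℝ × ℝ} (hv : v ∈ unitDisk) :
    invAbs (gcap v) ≤ invAbs (Real.sqrt (1 - v.2 ^ 2) - |v.1|) ^ (1 / 2 : ℝ)
      * invAbs (1 - |v.2|) ^ (1 / 4 : ℝ) := by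
  have hd : v.1 ^ 2 + v.2 ^ 2 < 1 := hv
  set c := Real.sqrt (1 - v.2 ^ 2) with hc
  have hy : 0 < 1 - v.2 ^ 2 := by nlinarith [sq_nonneg v.1]
  have hc0 : 0 < c := Real.sqrt_pos.2 hy
  have hc2 : c ^ 2 = 1 - v.2 ^ 2 := Real.sq_sqrt hy.le
  have hxc : |v.1| < c := abs_lt_of_sq_lt_sq (by linarith) hc0.le
  have hy1 : |v.2| < 1 := abs_lt_of_sq_lt_sq (by linarith) one_pos.le
  have hle : (c - |v.1|) * c ≤ 1 - (v.1 ^ 2 + v.2 ^ 2) ^ 2 := by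
    have h1 := sq_abs v.1
    nlinarith [abs_nonneg v.1, sq_nonneg v.1, sq_nonneg v.2]
  have hc4 : invAbs c ^ (1 / 2 : ℝ) ≤ invAbs (1 - |v.2|) ^ (1 / 4 : ℝ) := by
    rw [hc, invAbs_sqrt hy.le, ← ENNReal.rpow_mul]
    norm_num
    refine ENNReal.rpow_le_rpow (invAbs_anti ?_) (by norm_num)
    rw [abs_of_pos hy, abs_of_pos (by linarith)]
    nlinarith [sq_abs v.2, abs_nonneg v.2]
  calc invAbs (gcap v) ≤ invAbs (Real.sqrt ((c - |v.1|) * c)) := by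
        refine invAbs_anti ?_
        rw [abs_of_nonneg (Real.sqrt_nonneg _), gcap, abs_of_nonneg (Real.sqrt_nonneg _)]
        exact Real.sqrt_le_sqrt hle
    _ = invAbs (c - |v.1|) ^ (1 / 2 : ℝ) * invAbs c ^ (1 / 2 : ℝ) := by
        rw [invAbs_sqrt (mul_nonneg (by linarith) hc0.le), invAbs_mul,
          ENNReal.mul_rpow_of_nonneg _ _ (by norm_num)]
    _ ≤ _ := by gcongr

/-- A one-dimensional kernel with singularities of order `7/8` at `±c` and `a`. -/
def edgeKernel (c a s : ℝ) : ENNReal :=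
  invAbs (s - c) ^ (7 / 8 : ℝ) + invAbs (s - a) ^ (7 / 8 : ℝ)
    + (invAbs (s - -c) ^ (7 / 8 : ℝ) + invAbs (s - a) ^ (7 / 8 : ℝ))

lemma invAbs_sub_abs_rpow_mul_le_edgeKernel (c a s : ℝ) {α β : ℝ} (hα : 0 ≤ α) (hβ : 0 ≤ β)
    (h : α + β = 7 / 8) :
    invAbs (c - |s|) ^ α * invAbs (s - a) ^ β ≤ edgeKernel c a s := by
  refine (mul_le_mul_left (invAbs_sub_abs_rpow_le c s α) _).trans ?_
  rw [add_mul, edgeKernel, ← h]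
  exact add_le_add (rpow_mul_rpow_le_add _ _ hα hβ) (rpow_mul_rpow_le_add _ _ hα hβ)

lemma measurable_edgeKernel {ι : Type*} [MeasurableSpace ι] (a : ℝ) {c s : ι → ℝ}
    (hc : Measurable c) (hs : Measurable s) : Measurable fun i => edgeKernel (c i) a (s i) := by
  have h1 := (measurable_invAbs_rpow (7 / 8)).comp (hs.sub hc)
  have h2 := (measurable_invAbs_rpow (7 / 8)).comp (hs.sub_const a)
  have h3 := (measurable_invAbs_rpow (7 / 8)).comp (hs.sub hc.neg)
  exact (h1.add h2).add (h3.add h2)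

lemma exists_setLIntegral_edgeKernel_le :
    ∃ K : ENNReal, K ≠ ⊤ ∧ ∀ c a : ℝ, ∫⁻ s in Set.Ioo (-1 : ℝ) 1, edgeKernel c a s ≤ K := by
  obtain ⟨K, hK, hle⟩ := exists_setLIntegral_invAbs_sub_rpow_le
  refine ⟨K + K + (K + K), by simp [hK], fun c a => ?_⟩
  have hm (b : ℝ) : Measurable fun s : ℝ => invAbs (s - b) ^ (7 / 8 : ℝ) :=
    (measurable_invAbs_rpow _).comp (measurable_id.sub_const b)
  unfold edgeKernel
  rw [lintegral_add_left (by fun_prop), lintegral_add_left (hm c),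
    lintegral_add_left (hm (-c))]
  exact add_le_add (add_le_add (hle _) (hle _)) (add_le_add (hle _) (hle _))

lemma exists_setLIntegral_edgeKernel_mul_le :
    ∃ K : ENNReal, K ≠ ⊤ ∧ ∀ a b : ℝ,
      ∫⁻ v in unitDisk, edgeKernel (Real.sqrt (1 - v.2 ^ 2)) a v.1 * edgeKernel 1 b v.2 ≤ K := by
  obtain ⟨K, hK, hle⟩ := exists_setLIntegral_edgeKernel_le
  refine ⟨K * K, ENNReal.mul_ne_top hK hK, fun a b => ?_⟩
  have hsub : unitDisk ⊆ Set.Ioo (-1 : ℝ) 1 ×ˢ Set.Ioo (-1 : ℝ) 1 := by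
    intro v hv
    have hd : v.1 ^ 2 + v.2 ^ 2 < 1 := hv
    exact ⟨abs_lt.1 (abs_lt_of_sq_lt_sq (by nlinarith [sq_nonneg v.2]) one_pos.le),
      abs_lt.1 (abs_lt_of_sq_lt_sq (by nlinarith [sq_nonneg v.1]) one_pos.le)⟩
  have hm : Measurable fun v : ℝ × ℝ =>
      edgeKernel (Real.sqrt (1 - v.2 ^ 2)) a v.1 * edgeKernel 1 b v.2 :=
    (measurable_edgeKernel a (by fun_prop) measurable_fst).mul
      (measurable_edgeKernel b measurable_const measurable_snd)
  refine (lintegral_mono_set hsub).trans ?_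
  rw [Measure.volume_eq_prod, ← Measure.prod_restrict, lintegral_prod_symm _ hm.aemeasurable]
  calc ∫⁻ y in Set.Ioo (-1 : ℝ) 1, ∫⁻ x in Set.Ioo (-1 : ℝ) 1,
        edgeKernel (Real.sqrt (1 - y ^ 2)) a x * edgeKernel 1 b y
      ≤ ∫⁻ y in Set.Ioo (-1 : ℝ) 1, K * edgeKernel 1 b y := by
        refine lintegral_mono fun y => ?_
        dsimp only
        rw [lintegral_mul_const _ (measurable_edgeKernel a measurable_const measurable_id')]
        exact mul_le_mul_left (hle _ _) _
    _ = K * ∫⁻ y in Set.Ioo (-1 : ℝ) 1, edgeKernel 1 b y :=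
        lintegral_const_mul _ (measurable_edgeKernel b measurable_const measurable_id')
    _ ≤ K * K := by gcongr; exact hle _ _

lemma lintegral_map_graph_le {u : ℝ × ℝ → ℝ}
    (hu : ∀ v ∈ unitDisk, graphDens u v ≤ 3 / gcap v) (f : ℝ × ℝ → Heis)
    (hf1 : ∀ v, (f v).1 = v.1) (hf2 : ∀ v, (f v).2.1 = v.2) (q : Heis) :
    ∫⁻ x, ENNReal.ofReal (rho (Hmul (Hinv q) x))⁻¹
        ∂Measure.map f
          ((volume.restrict unitDisk).withDensity fun v => ENNReal.ofReal (graphDens u v))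
      ≤ 3 * ∫⁻ v in unitDisk,
        edgeKernel (Real.sqrt (1 - v.2 ^ 2)) q.1 v.1 * edgeKernel 1 q.2.1 v.2 := by
  refine (lintegral_map_le _ _).trans ?_
  refine (lintegral_withDensity_le_lintegral_mul _
    (measurable_graphDens u).ennreal_ofReal _).trans ?_
  rw [← lintegral_const_mul' _ _ (by simp)]
  have hdisk : MeasurableSet unitDisk :=
    measurableSet_lt (by fun_prop : Measurable fun v : ℝ × ℝ => v.1 ^ 2 + v.2 ^ 2) measurable_const
  refine setLIntegral_mono' hdisk fun v hv => ?_
  have hdens : ENNReal.ofReal (graphDens u v) ≤ 3 * invAbs (gcap v) := by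
    refine (ENNReal.ofReal_le_ofReal (hu v hv)).trans ?_
    rw [div_eq_mul_inv, ENNReal.ofReal_mul (by norm_num)]
    simpa using mul_le_mul_right (ofReal_inv_le_invAbs (gcap v)) 3
  have hrho := ofReal_inv_rho_le q (f v)
  rw [hf1, hf2] at hrho
  have hx := invAbs_sub_abs_rpow_mul_le_edgeKernel (Real.sqrt (1 - v.2 ^ 2)) q.1 v.1
    (α := 1 / 2) (β := 3 / 8) (by norm_num) (by norm_num) (by norm_num)
  have hy := invAbs_sub_abs_rpow_mul_le_edgeKernel 1 q.2.1 v.2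
    (α := 1 / 4) (β := 5 / 8) (by norm_num) (by norm_num) (by norm_num)
  calc _ ≤ 3 * (invAbs (Real.sqrt (1 - v.2 ^ 2) - |v.1|) ^ (1 / 2 : ℝ)
          * invAbs (1 - |v.2|) ^ (1 / 4 : ℝ))
        * (invAbs (v.1 - q.1) ^ (3 / 8 : ℝ) * invAbs (v.2 - q.2.1) ^ (5 / 8 : ℝ)) :=
        mul_le_mul' (hdens.trans (by gcongr; exact invAbs_gcap_le hv)) hrho
    _ = 3 * ((invAbs (Real.sqrt (1 - v.2 ^ 2) - |v.1|) ^ (1 / 2 : ℝ)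
          * invAbs (v.1 - q.1) ^ (3 / 8 : ℝ))
        * (invAbs (1 - |v.2|) ^ (1 / 4 : ℝ) * invAbs (v.2 - q.2.1) ^ (5 / 8 : ℝ))) := by ring
    _ ≤ _ := by gcongr

/-- `∫_{∂B₁} ρ(q⁻¹x)⁻¹ dσ(x)` is bounded uniformly in `q ∈ ℍ¹`. -/
theorem sphere_integral_uniformly_bounded :
    ∃ C : ℝ, 0 ≤ C ∧ ∀ q : Heis,
      ∫⁻ x, ENNReal.ofReal (rho (Hmul (Hinv q) x))⁻¹ ∂sigmaSphere ≤ ENNReal.ofReal C := by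
  obtain ⟨K, hK, hle⟩ := exists_setLIntegral_edgeKernel_mul_le
  have hfin : 3 * K + 3 * K ≠ ⊤ := by simp [ENNReal.mul_eq_top, hK]
  refine ⟨(3 * K + 3 * K).toReal, ENNReal.toReal_nonneg, fun q => ?_⟩
  rw [ENNReal.ofReal_toReal hfin, sigmaSphere, lintegral_add_measure]
  refine add_le_add ?_ ?_
  · refine (lintegral_map_graph_le (fun v hv => ?_) _ (fun _ => rfl) (fun _ => rfl) q).trans
      (by gcongr; exact hle _ _)
    exact (graphDens_gcap_eq hv).trans_le (sqrt_add_le_three_div_gcap hv)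
  · refine (lintegral_map_graph_le (fun v hv => ?_) _ (fun _ => rfl) (fun _ => rfl) q).trans
      (by gcongr; exact hle _ _)
    exact (graphDens_neg_gcap_eq hv).trans_le (sqrt_add_le_three_div_gcap hv)

end
end

section
/- On ℍ¹∖{0}, the sub-Laplacian of the logarithm of the Korányi norm satisfies Δ_b ( log(|z|⁴+t²)^{1/4} ) = 2|z|²/(|z|⁴+t²), where z = x+iy. -/
open MeasureTheory Real

noncomputable section

/-- The polynomial `ρ⁴` is positive away from the origin. -/
theorem koranyi_gauge_pos {p : Heis} (hp : p ≠ (0, 0, 0)) :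
    0 < (p.1 ^ 2 + p.2.1 ^ 2) ^ 2 + p.2.2 ^ 2 := by
  obtain ⟨x, y, t⟩ := p
  by_contra! h
  have ht : t = 0 := by
    have : t ^ 2 = 0 := by nlinarith [sq_nonneg (x ^ 2 + y ^ 2), sq_nonneg t]
    simpa using this
  have hr : x ^ 2 + y ^ 2 = 0 := by
    have : (x ^ 2 + y ^ 2) ^ 2 = 0 := by nlinarith [sq_nonneg (x ^ 2 + y ^ 2), sq_nonneg t]
    simpa using this
  have hx : x = 0 := by
    have : x ^ 2 = 0 := by nlinarith [sq_nonneg x, sq_nonneg y]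
    simpa using this
  have hy : y = 0 := by
    have : y ^ 2 = 0 := by nlinarith [sq_nonneg x, sq_nonneg y]
    simpa using this
  exact hp (by rw [hx, hy, ht])

theorem hasFDerivAt_coord_x (p : Heis) :
    HasFDerivAt (fun q : Heis => q.1) (ContinuousLinearMap.fst ℝ ℝ (ℝ × ℝ)) p :=
  hasFDerivAt_fst

theorem hasFDerivAt_coord_y (p : Heis) :
    HasFDerivAt (fun q : Heis => q.2.1)
      ((ContinuousLinearMap.fst ℝ ℝ ℝ).comp (ContinuousLinearMap.snd ℝ ℝ (ℝ × ℝ))) p :=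
  hasFDerivAt_snd.fst

theorem hasFDerivAt_coord_t (p : Heis) :
    HasFDerivAt (fun q : Heis => q.2.2)
      ((ContinuousLinearMap.snd ℝ ℝ ℝ).comp (ContinuousLinearMap.snd ℝ ℝ (ℝ × ℝ))) p :=
  hasFDerivAt_snd.snd

/-- The directional derivative of `log ρ` away from the origin. -/
theorem fderiv_log_rho {p : Heis} (hp : p ≠ (0, 0, 0)) (v : Heis) :
    fderiv ℝ (fun q : Heis =>
        Real.log (((q.1 ^ 2 + q.2.1 ^ 2) ^ 2 + q.2.2 ^ 2) ^ ((1 : ℝ) / 4))) p v =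
      ((p.1 ^ 2 + p.2.1 ^ 2) * (p.1 * v.1 + p.2.1 * v.2.1) + p.2.2 * v.2.2 / 2) /
        ((p.1 ^ 2 + p.2.1 ^ 2) ^ 2 + p.2.2 ^ 2) := by
  have hN := koranyi_gauge_pos hp
  have h := ((((((hasFDerivAt_coord_x p).pow 2).add ((hasFDerivAt_coord_y p).pow 2)).pow 2).add
    ((hasFDerivAt_coord_t p).pow 2)).log hN.ne').const_mul ((1 : ℝ) / 4)
  have hlog : (fun q : Heis =>
        Real.log (((q.1 ^ 2 + q.2.1 ^ 2) ^ 2 + q.2.2 ^ 2) ^ ((1 : ℝ) / 4))) =ᶠ[nhds p]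
      fun q => (1 : ℝ) / 4 * Real.log ((q.1 ^ 2 + q.2.1 ^ 2) ^ 2 + q.2.2 ^ 2) := by
    filter_upwards [isOpen_ne.mem_nhds hp] with q hq
    exact Real.log_rpow (koranyi_gauge_pos hq) _
  rw [(h.congr_of_eventuallyEq hlog).fderiv]
  simp
  field_simp
  ring

/-- The directional derivative of a quotient `(a (x² + y²) + b t) / ρ⁴`, where `a` and `b` are
differentiable. -/
theorem fderiv_div_gauge {a b : Heis → ℝ} {a' b' : Heis →L[ℝ] ℝ} {p : Heis}
    (hp : p ≠ (0, 0, 0)) (ha : HasFDerivAt a a' p) (hb : HasFDerivAt b b' p) (v : Heis) :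
    fderiv ℝ (fun q : Heis => (a q * (q.1 ^ 2 + q.2.1 ^ 2) + b q * q.2.2) /
        ((q.1 ^ 2 + q.2.1 ^ 2) ^ 2 + q.2.2 ^ 2)) p v =
      (a' v * (p.1 ^ 2 + p.2.1 ^ 2) + a p * (2 * p.1 * v.1 + 2 * p.2.1 * v.2.1) +
          b' v * p.2.2 + b p * v.2.2) / ((p.1 ^ 2 + p.2.1 ^ 2) ^ 2 + p.2.2 ^ 2) -
        (a p * (p.1 ^ 2 + p.2.1 ^ 2) + b p * p.2.2) *
          (4 * (p.1 ^ 2 + p.2.1 ^ 2) * (p.1 * v.1 + p.2.1 * v.2.1) + 2 * p.2.2 * v.2.2) /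
          ((p.1 ^ 2 + p.2.1 ^ 2) ^ 2 + p.2.2 ^ 2) ^ 2 := by
  have hN := koranyi_gauge_pos hp
  have hr := ((hasFDerivAt_coord_x p).pow 2).add ((hasFDerivAt_coord_y p).pow 2)
  have h := ((ha.mul hr).add (hb.mul (hasFDerivAt_coord_t p))).mul
    ((hasDerivAt_inv hN.ne').comp_hasFDerivAt p ((hr.pow 2).add ((hasFDerivAt_coord_t p).pow 2)))
  simp only [div_eq_mul_inv]
  erw [h.fderiv]
  simp
  field_simp
  ring

/-- `Δ_b (log(|z|⁴+t²)^{1/4}) = 2|z|²/(|z|⁴+t²)` on `ℍ¹∖{0}`. -/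
theorem subLap_log_rho (p : Heis) (hp : p ≠ (0, 0, 0)) :
    subLap (fun q => Real.log (((q.1 ^ 2 + q.2.1 ^ 2) ^ 2 + q.2.2 ^ 2) ^ ((1 : ℝ) / 4))) p =
      2 * (p.1 ^ 2 + p.2.1 ^ 2) / ((p.1 ^ 2 + p.2.1 ^ 2) ^ 2 + p.2.2 ^ 2) := by
  have hN := koranyi_gauge_pos hp
  have hX : Xd (fun q => Real.log (((q.1 ^ 2 + q.2.1 ^ 2) ^ 2 + q.2.2 ^ 2) ^ ((1 : ℝ) / 4)))
      =ᶠ[nhds p] fun q => (q.1 * (q.1 ^ 2 + q.2.1 ^ 2) + q.2.1 * q.2.2) /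
        ((q.1 ^ 2 + q.2.1 ^ 2) ^ 2 + q.2.2 ^ 2) := by
    filter_upwards [isOpen_ne.mem_nhds hp] with q hq
    rw [Xd, fderiv_log_rho hq]
    ring
  have hY : Yd (fun q => Real.log (((q.1 ^ 2 + q.2.1 ^ 2) ^ 2 + q.2.2 ^ 2) ^ ((1 : ℝ) / 4)))
      =ᶠ[nhds p] fun q => (q.2.1 * (q.1 ^ 2 + q.2.1 ^ 2) + -q.1 * q.2.2) /
        ((q.1 ^ 2 + q.2.1 ^ 2) ^ 2 + q.2.2 ^ 2) := by
    filter_upwards [isOpen_ne.mem_nhds hp] with q hq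
    rw [Yd, fderiv_log_rho hq]
    ring
  rw [subLap, Xd, Yd, hX.fderiv_eq, hY.fderiv_eq,
    fderiv_div_gauge hp (hasFDerivAt_coord_x p) (hasFDerivAt_coord_y p),
    fderiv_div_gauge hp (hasFDerivAt_coord_y p) (hasFDerivAt_coord_x p).fun_neg]
  simp
  field_simp
  ring

end
end
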